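/- arXiv:2402.07009 — 3 statements merged into one kernel-verified Lean document; each statement's English description precedes it below -/
import Mathlib

section
/- Let Γ be a nontrivial connected simple graph with p ≥ 2 vertices, minimum degree δ(Γ) ≥ 2 and girth at least 5. Then γ_{[3R]}(Γ) ≤ 2p − 2Δ(Γ) + 1, where Δ(Γ) is the maximum degree of Γ. -/
open SimpleGraph Finset

/-- A triple Roman dominating function (3RDF) on a simple graph `G`:
labels are at most 4; a vertex labeled 0 has a neighbour labeled 4, or a
neighbour labeled 2 and a neighbour labeled 3, or three neighbours labeled 2;
a vertex labeled 1 has a neighbour labeled at least 3 or two neighbours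
labeled 2; a vertex labeled 2 has a neighbour labeled at least 2. -/
def IsTRDF {V : Type*} (G : SimpleGraph V) (h : V → ℕ) : Prop :=
  (∀ v, h v ≤ 4) ∧
  (∀ v, h v = 0 →
    (∃ u, G.Adj v u ∧ h u = 4) ∨
    (∃ u w, G.Adj v u ∧ G.Adj v w ∧ h u = 2 ∧ h w = 3) ∨
    (∃ u w x, G.Adj v u ∧ G.Adj v w ∧ G.Adj v x ∧ u ≠ w ∧ u ≠ x ∧ w ≠ x ∧
      h u = 2 ∧ h w = 2 ∧ h x = 2)) ∧
  (∀ v, h v = 1 →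
    (∃ u, G.Adj v u ∧ 3 ≤ h u) ∨
    (∃ u w, G.Adj v u ∧ G.Adj v w ∧ u ≠ w ∧ h u = 2 ∧ h w = 2)) ∧
  (∀ v, h v = 2 → ∃ u, G.Adj v u ∧ 2 ≤ h u)

/-- The triple Roman domination number: the minimum weight of a 3RDF on `G`. -/
noncomputable def tripleRomanNumber {V : Type*} [Fintype V] (G : SimpleGraph V) : ℕ :=
  sInf {w | ∃ h : V → ℕ, IsTRDF G h ∧ ∑ v, h v = w}

/-- A graph of girth at least four has no triangles. -/
theorem not_adj_of_four_le_girth {V : Type*} {G : SimpleGraph V} (hg : 4 ≤ G.girth) {a b c : V}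
    (hab : G.Adj a b) (hbc : G.Adj b c) : ¬ G.Adj c a := by
  intro hca
  have hcyc : (Walk.cons hab (Walk.cons hbc (Walk.cons hca Walk.nil))).IsCycle := by
    have := hab.ne
    have := hbc.ne
    have := hca.ne
    simp [Walk.isCycle_def, Walk.isTrail_def]
    grind
  have := hcyc.girth_le_length
  simp at this
  omega

/-- In a graph of girth at least five, two distinct vertices have at most one common neighbour. -/
theorem eq_of_adj_of_five_le_girth {V : Type*} {G : SimpleGraph V} (hg : 5 ≤ G.girth)
    {a b c d : V} (hab : G.Adj a b) (hbc : G.Adj b c) (hcd : G.Adj c d) (hda : G.Adj d a)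
    (hac : a ≠ c) : b = d := by
  by_contra hbd
  have hcyc : (Walk.cons hab (Walk.cons hbc (Walk.cons hcd (Walk.cons hda Walk.nil)))).IsCycle := by
    have := hab.ne
    have := hbc.ne
    have := hcd.ne
    have := hda.ne
    simp [Walk.isCycle_def, Walk.isTrail_def]
    grind
  have := hcyc.girth_le_length
  simp at this
  omega

/-- A vertex of degree at least two has a neighbour different from any prescribed vertex. -/
theorem exists_adj_ne_of_two_le_degree {V : Type*} {G : SimpleGraph V} (a b : V)
    [Fintype (G.neighborSet a)] (h : 2 ≤ G.degree a) : ∃ c, G.Adj a c ∧ c ≠ b := by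
  obtain ⟨c, hc, hne⟩ := Finset.exists_mem_ne (s := G.neighborFinset a) h b
  exact ⟨c, by simpa using hc, hne⟩

open Classical in
/-- The labelling with value 3 at `v`, 0 on the neighbours of `v`, and 2 elsewhere. -/
noncomputable def starLabel {V : Type*} (G : SimpleGraph V) (v x : V) : ℕ :=
  if x = v then 3 else if G.Adj v x then 0 else 2

theorem isTRDF_starLabel {V : Type*} [Fintype V] {G : SimpleGraph V} [DecidableRel G.Adj]
    (hδ : 2 ≤ G.minDegree) (hg : 5 ≤ G.girth) (v : V) : IsTRDF G (starLabel G v) := by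
  have key (a b : V) := exists_adj_ne_of_two_le_degree a b (hδ.trans (G.minDegree_le_degree a))
  refine ⟨fun x => ?_, fun x hx => ?_, fun x hx => ?_, fun x hx => ?_⟩
  · unfold starLabel
    split_ifs <;> omega
  · have hvx : G.Adj v x := by
      unfold starLabel at hx
      split_ifs at hx
      assumption
    obtain ⟨c, hxc, hcv⟩ := key x v
    have hvc : ¬ G.Adj v c := fun h =>
      not_adj_of_four_le_girth (by omega) hvx hxc h.symm
    exact .inr (.inl ⟨c, v, hxc, hvx.symm, by simp [starLabel, hcv, hvc], by simp [starLabel]⟩)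
  · unfold starLabel at hx
    split_ifs at hx <;> omega
  · have hxv : x ≠ v ∧ ¬ G.Adj v x := by
      unfold starLabel at hx
      split_ifs at hx with h₁ h₂
      · omega
      · exact ⟨h₁, h₂⟩
    obtain ⟨b, hxb, -⟩ := key x x
    by_cases hvb : G.Adj v b
    · obtain ⟨c, hxc, hcb⟩ := key x b
      have hvc : ¬ G.Adj v c := fun h =>
        hcb (eq_of_adj_of_five_le_girth hg hxc h.symm hvb hxb.symm hxv.1)
      refine ⟨c, hxc, ?_⟩
      unfold starLabel
      split_ifs <;> omega
    · refine ⟨b, hxb, ?_⟩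
      unfold starLabel
      split_ifs <;> omega

theorem sum_starLabel {V : Type*} [Fintype V] (G : SimpleGraph V) [DecidableRel G.Adj] (v : V) :
    ∑ x, starLabel G v x + 2 * G.degree v = 2 * Fintype.card V + 1 := by
  classical
  have hpt (x : V) : starLabel G v x + 2 * (if G.Adj v x then 1 else 0) =
      2 + if x = v then 1 else 0 := by
    by_cases hx : x = v
    · simp [starLabel, hx]
    · by_cases hvx : G.Adj v x <;> simp [starLabel, hx, hvx]
  have hdeg : G.degree v = ∑ x, if G.Adj v x then 1 else 0 := by
    rw [← Finset.card_filter, ← neighborFinset_eq_filter, card_neighborFinset_eq_degree]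
  rw [hdeg, Finset.mul_sum, ← Finset.sum_add_distrib, Finset.sum_congr rfl fun x _ => hpt x]
  simp [Finset.sum_add_distrib, mul_comm]

/-- If `Γ` is a nontrivial connected graph with `p ≥ 2` vertices, minimum degree
at least 2 and girth at least 5, then `γ_[3R](Γ) ≤ 2p - 2Δ + 1`. -/
theorem tripleRoman_le_of_girth_five {V : Type*} [Fintype V] (G : SimpleGraph V)
    [DecidableRel G.Adj] (p Δ : ℕ) (hp : Fintype.card V = p) (hΔ : G.maxDegree = Δ)
    (hconn : G.Connected) (hp2 : 2 ≤ p) (hδ : 2 ≤ G.minDegree)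
    (hgirth : 5 ≤ G.girth) :
    (tripleRomanNumber G : ℤ) ≤ 2 * p - 2 * Δ + 1 := by
  have := hconn.nonempty
  obtain ⟨v, hv⟩ := G.exists_maximal_degree_vertex
  have hle : tripleRomanNumber G ≤ ∑ x, starLabel G v x :=
    Nat.sInf_le ⟨_, isTRDF_starLabel hδ hgirth v, rfl⟩
  have := sum_starLabel G v
  omega
end

section
/- Let Γ be a nontrivial connected simple graph with order p, maximum degree Δ, and domination number γ = γ(Γ). Then γ_{[3R]}(Γ) ≥ ⌈(2p + (Δ − 1)γ)/Δ⌉. -/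
open SimpleGraph Finset

/-- `S` is a dominating set of `G`: every vertex outside `S` has a neighbour in `S`. -/
def IsDomSet {V : Type*} (G : SimpleGraph V) (S : Finset V) : Prop :=
  ∀ v ∉ S, ∃ u ∈ S, G.Adj v u

/-- The domination number of `G`. -/
noncomputable def dominationNumber {V : Type*} [Fintype V] (G : SimpleGraph V) : ℕ :=
  sInf {n | ∃ S : Finset V, IsDomSet G S ∧ S.card = n}

/-- The amount that a vertex labeled `n` sends to each neighbour labeled at most 1
in the discharging argument. -/
def dischargeAmount (n : ℕ) : ℕ := if n < 2 then 0 else if n = 4 then 2 else 1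

lemma dominationNumber_le_card {V : Type*} [Fintype V] {G : SimpleGraph V} {S : Finset V}
    (hS : IsDomSet G S) : dominationNumber G ≤ S.card :=
  Nat.sInf_le ⟨S, hS, rfl⟩

lemma IsTRDF.isDomSet {V : Type*} [Fintype V] {G : SimpleGraph V} {h : V → ℕ}
    (hh : IsTRDF G h) : IsDomSet G (univ.filter fun v => 2 ≤ h v) := by
  intro v hv
  simp only [mem_filter, mem_univ, true_and, not_le] at hv ⊢
  obtain ⟨-, h0, h1, -⟩ := hh
  obtain hv | hv : h v = 0 ∨ h v = 1 := by omega
  · rcases h0 v hv with ⟨u, hu, e⟩ | ⟨u, -, hu, -, e, -⟩ | ⟨u, -, -, hu, -, -, -, -, -, e, -⟩ <;>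
      exact ⟨u, by omega, hu⟩
  · rcases h1 v hv with ⟨u, hu, e⟩ | ⟨u, -, hu, -, -, e, -⟩ <;>
      exact ⟨u, by omega, hu⟩

lemma exists_isTRDF_sum_eq_tripleRomanNumber {V : Type*} [Fintype V] (G : SimpleGraph V) :
    ∃ h : V → ℕ, IsTRDF G h ∧ ∑ v, h v = tripleRomanNumber G :=
  Nat.sInf_mem (s := {w | ∃ h : V → ℕ, IsTRDF G h ∧ ∑ v, h v = w})
    ⟨_, fun _ => 3, by simp [IsTRDF], rfl⟩

section Discharging

variable {V : Type*} [Fintype V] {G : SimpleGraph V} [DecidableRel G.Adj] {h : V → ℕ}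

lemma IsTRDF.two_le_sum_dischargeAmount (hh : IsTRDF G h) {v : V} (hv : h v = 0) :
    2 ≤ ∑ u ∈ G.neighborFinset v, dischargeAmount (h u) := by
  classical
  have key (s : Finset V) (hs : ∀ u ∈ s, G.Adj v u) :
      ∑ u ∈ s, dischargeAmount (h u) ≤ ∑ u ∈ G.neighborFinset v, dischargeAmount (h u) :=
    sum_le_sum_of_subset fun u hu => (G.mem_neighborFinset v u).2 (hs u hu)
  rcases hh.2.1 v hv with ⟨u, hu, e⟩ | ⟨u, w, hu, hw, e, e'⟩ |
    ⟨u, w, -, hu, hw, -, huw, -, -, e, e', -⟩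
  · simpa [dischargeAmount, e] using key {u} (by simpa)
  · have huw : u ≠ w := by rintro rfl; omega
    simpa [sum_pair huw, dischargeAmount, e, e'] using key {u, w} (by simp [hu, hw])
  · simpa [sum_pair huw, dischargeAmount, e, e'] using key {u, w} (by simp [hu, hw])

lemma IsTRDF.one_le_sum_dischargeAmount (hh : IsTRDF G h) {v : V} (hv : h v = 1) :
    1 ≤ ∑ u ∈ G.neighborFinset v, dischargeAmount (h u) := by
  obtain ⟨u, hu, e⟩ : ∃ u, G.Adj v u ∧ 2 ≤ h u := by
    rcases hh.2.2.1 v hv with ⟨u, hu, e⟩ | ⟨u, -, hu, -, -, e, -⟩ <;> exact ⟨u, hu, by omega⟩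
  calc 1 ≤ dischargeAmount (h u) := by unfold dischargeAmount; split_ifs <;> omega
    _ ≤ _ := single_le_sum (f := fun u => dischargeAmount (h u)) (fun _ _ => Nat.zero_le _)
      ((G.mem_neighborFinset v u).2 hu)

lemma card_filter_neighborFinset_le_maxDegree (v : V) (P : V → Prop) [DecidablePred P] :
    ((G.neighborFinset v).filter P).card ≤ G.maxDegree :=
  (card_filter_le _ _).trans (G.degree_le_maxDegree v)

lemma IsTRDF.card_filter_neighborFinset_lt_maxDegree (hh : IsTRDF G h) {v : V} (hv : h v = 2) :
    ((G.neighborFinset v).filter fun u => h u < 2).card < G.maxDegree := by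
  obtain ⟨u, hu, e⟩ := hh.2.2.2 v hv
  refine lt_of_lt_of_le (card_lt_card ?_) (G.degree_le_maxDegree v)
  exact filter_ssubset.2 ⟨u, (G.mem_neighborFinset v u).2 hu, by omega⟩

lemma sum_received_eq_sum_sent (G : SimpleGraph V) [DecidableRel G.Adj] (h : V → ℕ) :
    ∑ v, (if h v < 2 then ∑ u ∈ G.neighborFinset v, dischargeAmount (h u) else 0) =
      ∑ u, ((G.neighborFinset u).filter fun v => h v < 2).card * dischargeAmount (h u) := by
  simp_rw [← smul_eq_mul, ← sum_const, ← sum_filter]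
  refine sum_comm' fun v u => ?_
  simp [G.adj_comm, and_comm]

/-- The vertexwise balance of the discharging argument. -/
lemma IsTRDF.discharge_balance (hh : IsTRDF G h) (hΔ : 1 ≤ G.maxDegree) (v : V) :
    2 + (if 2 ≤ h v then G.maxDegree else 0) +
        ((G.neighborFinset v).filter fun u => h u < 2).card * dischargeAmount (h v) ≤
      G.maxDegree * h v + (if 2 ≤ h v then 1 else 0) +
        if h v < 2 then ∑ u ∈ G.neighborFinset v, dischargeAmount (h u) else 0 := by
  have hc := card_filter_neighborFinset_le_maxDegree (G := G) v fun u => h u < 2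
  have h4 := hh.1 v
  have h0 := hh.two_le_sum_dischargeAmount (v := v)
  have h1 := hh.one_le_sum_dischargeAmount (v := v)
  have h2 := hh.card_filter_neighborFinset_lt_maxDegree (v := v)
  generalize ((G.neighborFinset v).filter fun u => h u < 2).card = c at *
  generalize ∑ u ∈ G.neighborFinset v, dischargeAmount (h u) = r at *
  generalize G.maxDegree = d at *
  generalize h v = n at *
  interval_cases n <;> simp [dischargeAmount] at * <;> omega

lemma IsTRDF.two_mul_card_add_le (hh : IsTRDF G h) (hΔ : 1 ≤ G.maxDegree) :
    2 * Fintype.card V + G.maxDegree * (univ.filter fun v => 2 ≤ h v).card ≤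
      G.maxDegree * ∑ v, h v + (univ.filter fun v => 2 ≤ h v).card := by
  have key := sum_le_sum fun v (_ : v ∈ univ) => hh.discharge_balance hΔ v
  simp only [sum_add_distrib] at key
  rw [sum_received_eq_sum_sent, add_le_add_iff_right, ← sum_filter, ← sum_filter, ← mul_sum] at key
  simpa [mul_comm] using key

end Discharging

/-- Lower bound: `γ_[3R](Γ) ≥ ⌈(2p + (Δ - 1)·γ(Γ))/Δ⌉`. -/
theorem tripleRoman_lower_bound {V : Type*} [Fintype V] (G : SimpleGraph V)
    [DecidableRel G.Adj] (p Δ : ℕ) (hp : Fintype.card V = p) (hΔ : G.maxDegree = Δ)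
    (hconn : G.Connected) (hnt : 2 ≤ p) :
    ⌈(2 * p + (Δ - 1) * dominationNumber G : ℚ) / Δ⌉ ≤ (tripleRomanNumber G : ℤ) := by
  subst hp hΔ
  have : Nontrivial V := Fintype.one_lt_card_iff_nontrivial.1 hnt
  have hΔ : 1 ≤ G.maxDegree :=
    (hconn.preconnected.degree_pos_of_nontrivial hconn.nonempty.some).trans_le
      (G.degree_le_maxDegree _)
  obtain ⟨h, hh, hw⟩ := exists_isTRDF_sum_eq_tripleRomanNumber G
  have hγ := dominationNumber_le_card hh.isDomSet
  have key := hh.two_mul_card_add_le hΔ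
  rw [hw] at key
  have hΔ' : (1 : ℚ) ≤ G.maxDegree := by exact_mod_cast hΔ
  rw [Int.ceil_le, div_le_iff₀ (by linarith)]
  push_cast
  qify at hγ key
  nlinarith [mul_le_mul_of_nonneg_left hγ (sub_nonneg.2 hΔ')]
end

section
/- Let Γ be a nontrivial connected simple graph of order p containing at least one cycle, with girth g(Γ). Then γ_{[3R]}(Γ) ≤ 3p + 2 − (5·g(Γ))/3. -/
open SimpleGraph Finset

/-- The labels `0, 4, 0, 0, 4, 0, …` along a path on `n` vertices, with the last label raised to `3`
when `n % 3 = 1`. -/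
def pathLabel (n i : ℕ) : ℕ :=
  (if i % 3 = 1 then 4 else 0) + if i + 1 = n ∧ n % 3 = 1 then 3 else 0

lemma three_mul_sum_pathLabel_le (n : ℕ) : 3 * ∑ i ∈ range n, pathLabel n i ≤ 4 * n + 6 := by
  have periodic (m : ℕ) : ∑ i ∈ range m, (if i % 3 = 1 then 4 else 0) = 4 * ((m + 1) / 3) := by
    induction m with
    | zero => simp
    | succ m ih => rw [sum_range_succ, ih]; split_ifs <;> omega
  have last : ∑ i ∈ range n, (if i + 1 = n ∧ n % 3 = 1 then 3 else 0) =
      if n % 3 = 1 then 3 else 0 := by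
    cases n with
    | zero => simp
    | succ m => simp [ite_and]
  simp only [pathLabel, sum_add_distrib, periodic, last]
  split_ifs <;> omega

lemma isTRDF_extend_pathLabel {V : Type*} {G : SimpleGraph V} {n : ℕ} {e : Fin n → V}
    (he : Function.Injective e)
    (hadj : ∀ i j : Fin n, (i : ℕ) + 1 = j → G.Adj (e i) (e j)) :
    IsTRDF G (Function.extend e (fun i => pathLabel n i) fun _ => 3) := by
  set h := Function.extend e (fun i => pathLabel n i) fun _ => 3 with h_def
  have h_apply (i : Fin n) : h (e i) = pathLabel n i := he.extend_apply _ _ i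
  have h_zero_or (v : V) : h v = 3 ∨ h v = 4 ∨ (h v = 0 ∧ ∃ u, G.Adj v u ∧ h u = 4) := by
    by_cases hv : ∃ i, e i = v
    · obtain ⟨i, rfl⟩ := hv
      have hi := i.isLt
      rw [h_apply]
      by_cases h1 : (i : ℕ) % 3 = 1
      · right; left
        simp only [pathLabel]
        split_ifs <;> omega
      by_cases h2 : (i : ℕ) + 1 = n ∧ n % 3 = 1
      · left; simp [pathLabel, h1, h2]
      refine Or.inr (Or.inr ⟨by simp [pathLabel, h1, h2], ?_⟩)
      obtain ⟨j, hj, hij⟩ : ∃ j : Fin n, (j : ℕ) % 3 = 1 ∧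
          ((i : ℕ) + 1 = j ∨ (j : ℕ) + 1 = i) := by
        by_cases h0 : (i : ℕ) % 3 = 0
        · exact ⟨⟨i + 1, by omega⟩, by simp only; omega, Or.inl rfl⟩
        · exact ⟨⟨i - 1, by omega⟩, by simp only; omega, Or.inr (by simp only; omega)⟩
      refine ⟨e j, hij.elim (hadj i j) fun hji => (hadj j i hji).symm, ?_⟩
      rw [h_apply]
      have := j.isLt
      simp only [pathLabel]
      split_ifs <;> omega
    · exact Or.inl (Function.extend_apply' _ _ _ hv)
  refine ⟨fun v => ?_, fun v hv => Or.inl ?_, fun v hv => ?_, fun v hv => ?_⟩ <;>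
    rcases h_zero_or v with h3 | h4 | ⟨h0, hu⟩ <;> first | exact hu | omega

lemma sum_extend_const {V ι : Type*} [Fintype V] [Fintype ι] {e : ι → V}
    (he : Function.Injective e) (f : ι → ℕ) (c : ℕ) :
    ∑ v, Function.extend e f (fun _ => c) v + c * Fintype.card ι =
      ∑ i, f i + c * Fintype.card V := by
  classical
  have on_image : ∑ v ∈ univ.image e, Function.extend e f (fun _ => c) v = ∑ i, f i := by
    rw [sum_image he.injOn]
    exact sum_congr rfl fun i _ => he.extend_apply _ _ i
  have off_image : ∑ v ∈ (univ.image e)ᶜ, Function.extend e f (fun _ => c) v =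
      #(univ.image e)ᶜ * c := by
    refine sum_const_nat fun v hv => Function.extend_apply' _ _ _ ?_
    simpa using hv
  have card_split := card_add_card_compl (univ.image e)
  rw [card_image_of_injective _ he, card_univ] at card_split
  rw [← sum_add_sum_compl (univ.image e), on_image, off_image, ← card_split]
  ring

/-- For a nontrivial connected graph `Γ` of order `p` containing at least one cycle,
with girth `g(Γ) = g`, `γ_[3R](Γ) ≤ 3p + 2 - 5g/3`. -/
theorem tripleRoman_le_of_girth {V : Type*} [Fintype V] (G : SimpleGraph V) (p g : ℕ)
    (hp : Fintype.card V = p) (hconn : G.Connected) (hnt : 2 ≤ p)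
    (hcyc : ¬ G.IsAcyclic) (hg : G.girth = g) :
    (tripleRomanNumber G : ℚ) ≤ 3 * p + 2 - 5 * g / 3 := by
  obtain ⟨a, w, hw, hlen⟩ := exists_girth_eq_length.mpr hcyc
  rw [hg] at hlen
  let e : Fin g → V := fun i => w.getVert i
  have he : Function.Injective e := fun i j hij =>
    Fin.ext (hw.getVert_injOn' (by simp only [Set.mem_ofPred_eq]; omega)
      (by simp only [Set.mem_ofPred_eq]; omega) hij)
  have hadj (i j : Fin g) (hij : (i : ℕ) + 1 = j) : G.Adj (e i) (e j) := by
    simpa only [e, ← hij] using w.adj_getVert_succ (by omega : (i : ℕ) < w.length)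
  have hle : tripleRomanNumber G ≤ _ := Nat.sInf_le ⟨_, isTRDF_extend_pathLabel he hadj, rfl⟩
  have hsum := sum_extend_const he (fun i => pathLabel g i) 3
  have hbound := three_mul_sum_pathLabel_le g
  rw [← Fin.sum_univ_eq_sum_range] at hbound
  rw [Fintype.card_fin, hp] at hsum
  have hmain : 3 * tripleRomanNumber G + 5 * g ≤ 9 * p + 6 := by omega
  have : (3 * tripleRomanNumber G + 5 * g : ℚ) ≤ 9 * p + 6 := mod_cast hmain
  linarith
end
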